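/- In the setting of the change point model with minimal spacing δₙ = c₁·n^{1−ω} (0 ≤ ω < 1/8), bounded means ‖μ_i‖ ≤ B, M_u − M_l = 0, conditions (s₂) and (s₃), if a change point v with l < v < u satisfies ‖Θ_{l,u}^v‖ > Θ_{l,u} − 2C₁·log^p(n), then for all n sufficiently large one has min(v − l, u − v) ≥ δₙ − n^{5/8+ω}·log(n). -/

import Mathlib

open Filter MeasureTheory ProbabilityTheory

/-- Partial sum `S_k = ∑_{j=1}^k x_j`. -/
noncomputable def psum {H : Type*} [AddCommMonoid H] (x : ℕ → H) (k : ℕ) : H :=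
  ∑ j ∈ Finset.Icc 1 k, x j

/-- The (generalized) CUSUM process of the sequence `x` on the segment `(l, u]`:
`𝒮_{l,u}^k = √((u−l)/((u−k)(k−l))) • [S_k − S_l − ((k−l)/(u−l)) (S_u − S_l)]`. -/
noncomputable def cusum {H : Type*} [NormedAddCommGroup H] [NormedSpace ℝ H]
    (x : ℕ → H) (l u k : ℕ) : H :=
  Real.sqrt (((u : ℝ) - l) / (((u : ℝ) - k) * ((k : ℝ) - l))) •
    (psum x k - psum x l - (((k : ℝ) - l) / ((u : ℝ) - l)) • (psum x u - psum x l))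

section PartialSums

variable {H : Type*} [NormedAddCommGroup H] [NormedSpace ℝ H]

theorem psum_sub_psum_of_eq_const {x : ℕ → H} {c : H} {a b : ℕ} (hab : a ≤ b)
    (hx : ∀ i, a < i → i ≤ b → x i = c) :
    psum x b - psum x a = ((b : ℝ) - a) • c := by
  induction b, hab using Nat.le_induction with
  | base => simp
  | succ b hab ih =>
    have h : psum x (b + 1) = psum x b + x (b + 1) :=
      Finset.sum_Icc_succ_top (Nat.le_add_left 1 b) x
    have ih' := ih fun i h₁ h₂ => hx i h₁ (by lia)
    rw [h, hx (b + 1) (by lia) le_rfl, add_sub_right_comm, ih']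
    push_cast
    module

theorem norm_cusum_of_psum_eq {x : ℕ → H} {l u : ℕ} (h : psum x u = psum x l) (k : ℕ) :
    ‖cusum x l u k‖ =
      √(((u : ℝ) - l) / (((u : ℝ) - k) * ((k : ℝ) - l))) * ‖psum x k - psum x l‖ := by
  simp [cusum, h, norm_smul, abs_of_nonneg (Real.sqrt_nonneg _)]

theorem cusum_weight_eq {l u k : ℝ} (hl : l < k) (hu : k < u) :
    (u - l) / ((u - k) * (k - l)) = 1 / (k - l) + 1 / (u - k) := by
  have h₁ : k - l ≠ 0 := (sub_pos.2 hl).ne'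
  have h₂ : u - k ≠ 0 := (sub_pos.2 hu).ne'
  field_simp
  ring

theorem norm_cusum_le_mul_sqrt {x : ℕ → H} {l u k : ℕ} {B d : ℝ} (h : psum x u = psum x l)
    (hd : 0 < d) (hl : d ≤ (k : ℝ) - l) (hu : d ≤ (u : ℝ) - k)
    (hB : ‖psum x k - psum x l‖ ≤ d * B) :
    ‖cusum x l u k‖ ≤ B * √(2 * d) := by
  rw [norm_cusum_of_psum_eq h, cusum_weight_eq (by linarith) (by linarith)]
  have hw : 1 / ((k : ℝ) - l) + 1 / ((u : ℝ) - k) ≤ 2 * d / d ^ 2 := by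
    have h₁ := one_div_le_one_div_of_le hd hl
    have h₂ := one_div_le_one_div_of_le hd hu
    have h₃ : 2 * d / d ^ 2 = 1 / d + 1 / d := by field_simp; ring
    linarith
  calc _ ≤ √(2 * d / d ^ 2) * (d * B) := by gcongr
    _ = B * √(2 * d) := by
      rw [Real.sqrt_div' _ (by positivity), Real.sqrt_sq hd.le]
      field_simp

theorem norm_psum_sub_div_sqrt_le_norm_cusum {x : ℕ → H} {l u k n : ℕ}
    (h : psum x u = psum x l) (hl : l < k) (hu : k < u) (hn : u ≤ n) :
    ‖psum x k - psum x l‖ / √n ≤ ‖cusum x l u k‖ := by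
  have hl' : (l : ℝ) < k := by exact_mod_cast hl
  have hu' : (k : ℝ) < u := by exact_mod_cast hu
  have hn' : (u : ℝ) ≤ n := by exact_mod_cast hn
  have hl₀ : (0 : ℝ) ≤ l := l.cast_nonneg
  rw [norm_cusum_of_psum_eq h, cusum_weight_eq hl' hu', div_eq_inv_mul, ← Real.sqrt_inv]
  gcongr
  have h₁ : (n : ℝ)⁻¹ ≤ 1 / ((k : ℝ) - l) := by
    rw [← one_div]
    exact one_div_le_one_div_of_le (by linarith) (by linarith)
  have h₂ : 0 < 1 / ((u : ℝ) - k) := one_div_pos.2 (by linarith)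
  linarith

/-- If the mean jumps at `v`, the centred partial sums cannot all be small at
`v - h`, `v` and `v + h`. -/
theorem exists_le_norm_psum_sub {x : ℕ → H} {a b : H} {v h : ℕ} (l : ℕ) (hv : h ≤ v)
    (ha : ∀ i, v - h < i → i ≤ v → x i = a) (hb : ∀ i, v < i → i ≤ v + h → x i = b) :
    ∃ k, v - h ≤ k ∧ k ≤ v + h ∧ h * ‖b - a‖ / 4 ≤ ‖psum x k - psum x l‖ := by
  by_contra! hlt
  have h₁ := hlt (v - h) le_rfl (by lia)
  have h₂ := hlt v (by lia) (by lia)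
  have h₃ := hlt (v + h) (by lia) le_rfl
  have ea := psum_sub_psum_of_eq_const (Nat.sub_le v h) ha
  have eb := psum_sub_psum_of_eq_const (Nat.le_add_right v h) hb
  have e : (psum x (v + h) - psum x l) - (psum x v - psum x l)
      - ((psum x v - psum x l) - (psum x (v - h) - psum x l)) = (h : ℝ) • (b - a) := by
    rw [sub_sub_sub_cancel_right, sub_sub_sub_cancel_right, ea, eb]
    push_cast [hv]
    module
  have hn : ‖(h : ℝ) • (b - a)‖ = h * ‖b - a‖ := by simp [norm_smul]
  rw [← e] at hn
  have t₁ := norm_sub_le ((psum x (v + h) - psum x l) - (psum x v - psum x l))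
    ((psum x v - psum x l) - (psum x (v - h) - psum x l))
  have t₂ := norm_sub_le (psum x (v + h) - psum x l) (psum x v - psum x l)
  have t₃ := norm_sub_le (psum x v - psum x l) (psum x (v - h) - psum x l)
  linarith

end PartialSums

theorem add_le_of_forall_succ_sub_ge {v : ℕ → ℕ} {m : ℕ} {δ : ℝ} (hδ : 0 < δ)
    (hv : ∀ j, j ≤ m → δ ≤ (v (j + 1) : ℝ) - v j) {i k : ℕ} (hik : i < k) (hk : k ≤ m + 1) :
    (v i : ℝ) + δ ≤ v k := by
  induction k, hik using Nat.le_induction with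
  | base => linarith [hv i (by lia)]
  | succ k _ ih => linarith [hv k (by lia), ih (by lia)]

theorem eventually_log_rpow_le_mul_rpow (q : ℝ) {s ε : ℝ} (hs : 0 < s) (hε : 0 < ε) :
    ∀ᶠ n : ℕ in atTop, Real.log n ^ q ≤ ε * (n : ℝ) ^ s := by
  have h := ((isLittleO_log_rpow_rpow_atTop q hs).comp_tendsto
    tendsto_natCast_atTop_atTop).bound hε
  filter_upwards [h] with n hn
  have h₂ : 0 ≤ (n : ℝ) ^ s := by positivity
  simp only [Function.comp_apply, Real.norm_eq_abs, abs_of_nonneg h₂] at hn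
  exact (le_abs_self _).trans hn

theorem eventually_rpow_mul_log_le {s t ε : ℝ} (hst : s < t) (hε : 0 < ε) :
    ∀ᶠ n : ℕ in atTop, (n : ℝ) ^ s * Real.log n ≤ ε * (n : ℝ) ^ t := by
  filter_upwards [eventually_log_rpow_le_mul_rpow 1 (sub_pos.2 hst) hε,
    eventually_gt_atTop 0] with n hn hpos
  have hn₀ : (0 : ℝ) < n := by exact_mod_cast hpos
  rw [Real.rpow_one] at hn
  calc (n : ℝ) ^ s * Real.log n ≤ (n : ℝ) ^ s * (ε * (n : ℝ) ^ (t - s)) := by gcongr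
    _ = ε * ((n : ℝ) ^ s * (n : ℝ) ^ (t - s)) := by ring
    _ = ε * (n : ℝ) ^ t := by rw [← Real.rpow_add hn₀]; congr 2; ring

theorem eventually_cusum_bounds {Δ B c₁ ω C₁ p : ℝ}
    (hΔ : 0 < Δ) (hB : 0 < B) (hc₁ : 0 < c₁) (hω : ω < 1 / 8) (hC₁ : 0 < C₁) :
    ∀ᶠ n : ℕ in atTop, 0 < n ∧ 4 ≤ c₁ * (n : ℝ) ^ (1 - ω) ∧
      (n : ℝ) ^ ((5 : ℝ) / 8 + ω) * Real.log n ≤ c₁ * (n : ℝ) ^ (1 - ω) / 2 ∧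
      B * √(2 * ((n : ℝ) ^ ((5 : ℝ) / 8 + ω) * Real.log n)) + 2 * C₁ * Real.log n ^ p <
        c₁ * (n : ℝ) ^ (1 - ω) / 4 * Δ / 4 / √n := by
  have hδ : Tendsto (fun n : ℕ => c₁ * (n : ℝ) ^ (1 - ω)) atTop atTop :=
    ((tendsto_rpow_atTop (by linarith)).comp tendsto_natCast_atTop_atTop).const_mul_atTop hc₁
  set ε := Δ * c₁ / (64 * B) with hε
  have hε₀ : 0 < ε := by positivity
  filter_upwards [eventually_gt_atTop 0, hδ.eventually_ge_atTop 4,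
    eventually_rpow_mul_log_le (show (5 : ℝ) / 8 + ω < 1 - ω by linarith) (half_pos hc₁),
    eventually_rpow_mul_log_le (show (5 : ℝ) / 8 + ω < 2 * (1 / 2 - ω) by linarith)
      (show 0 < ε ^ 2 / 2 by positivity),
    eventually_log_rpow_le_mul_rpow p (show 0 < 1 / 2 - ω by linarith)
      (show 0 < Δ * c₁ / (128 * C₁) by positivity)] with n hn h4 ha hsq hlog
  have hn₀ : (0 : ℝ) < n := by exact_mod_cast hn
  refine ⟨hn, h4, by linarith, ?_⟩
  set y := (n : ℝ) ^ (1 / 2 - ω) with hy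
  have hy₀ : 0 < y := by positivity
  have hyy : (n : ℝ) ^ (2 * (1 / 2 - ω)) = y ^ 2 := by
    rw [hy, mul_comm, Real.rpow_mul hn₀.le, Real.rpow_two]
  have hdiv : (n : ℝ) ^ (1 - ω) = y * √n := by
    rw [hy, Real.sqrt_eq_rpow, ← Real.rpow_add hn₀]
    congr 1
    ring
  have hs : √(2 * ((n : ℝ) ^ ((5 : ℝ) / 8 + ω) * Real.log n)) ≤ ε * y := by
    apply Real.sqrt_le_iff.2 ⟨by positivity, ?_⟩
    rw [hyy] at hsq
    linarith [mul_pow ε y 2]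
  have hsqrt : 0 < √(n : ℝ) := Real.sqrt_pos.2 hn₀
  calc _ ≤ B * (ε * y) + 2 * C₁ * (Δ * c₁ / (128 * C₁) * y) := by gcongr
    _ = Δ * c₁ * y / 32 := by rw [hε]; field_simp; ring
    _ < Δ * c₁ * y / 16 := by
      have : 0 < Δ * c₁ * y := by positivity
      linarith
    _ = _ := by rw [hdiv]; field_simp; ring

/-- Equation (min_d) in the paper: under the change point model (minimal spacing
`δₙ = c₁ n^{1−ω}`, `0 ≤ ω < 1/8`, bounded means, `M_u − M_l = 0`, conditions (s₂) and (s₃)),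
a change point `v` with `l < v < u` satisfying `‖Θ_{l,u}^v‖ > Θ_{l,u} − 2C₁ log^p n` obeys
`min(v − l, u − v) ≥ δₙ − n^{5/8+ω} log n` for all `n` sufficiently large. -/
theorem near_max_change_point_far_from_endpoints
    {H : Type*} [NormedAddCommGroup H] [InnerProductSpace ℝ H]
    (Δ B c₁ ω C₁ p : ℝ)
    (hΔ : 0 < Δ) (hB : 0 < B) (hc₁ : 0 < c₁) (hω0 : 0 ≤ ω) (hω : ω < 1 / 8)
    (hC₁ : 0 < C₁) (hp : 1 < p) :
    ∃ N : ℕ, ∀ n : ℕ, N ≤ n →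
      ∀ (m i₀ β l u vcp : ℕ) (v : ℕ → ℕ) (μs um : ℕ → H) (ξ : ℝ),
        -- change point model on the whole sample
        v 0 = 0 → n ≤ v (m + 1) →
        (∀ j, j ≤ m → ∀ i, v j < i → i ≤ v (j + 1) → um i = μs (j + 1)) →
        (∀ j, 1 ≤ j → j ≤ m → Δ ≤ ‖μs (j + 1) - μs j‖) →
        (∀ j, 1 ≤ j → j ≤ m + 1 → ‖μs j‖ ≤ B) →
        (∀ j, j ≤ m → c₁ * (n : ℝ) ^ (1 - ω) ≤ (v (j + 1) : ℝ) - (v j : ℝ)) →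
        -- the segment `(l, u]`, with `β` change points `v_{i₀+1} < … < v_{i₀+β}` inside
        i₀ + β ≤ m → v i₀ ≤ l → l < v (i₀ + 1) → v (i₀ + β) < u → u ≤ v (i₀ + β + 1) → u ≤ n →
        -- `M_u − M_l = 0`
        psum um u = psum um l →
        -- condition (s₂)
        1 / 2 ≤ ξ → ξ < 1 →
        (∃ r, 1 ≤ r ∧ r ≤ β ∧
          (l : ℝ) < (v (i₀ + r) : ℝ) - ξ * (c₁ * (n : ℝ) ^ (1 - ω)) ∧
          (v (i₀ + r) : ℝ) + ξ * (c₁ * (n : ℝ) ^ (1 - ω)) < (u : ℝ)) →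
        -- condition (s₃)
        max ((min (v (i₀ + 1) - l) (l - v i₀) : ℕ) : ℝ)
            ((min (u - v (i₀ + β)) (v (i₀ + β + 1) - u) : ℕ) : ℝ) ≤
          (n : ℝ) ^ ((5 : ℝ) / 8 + ω) * Real.log n →
        -- `vcp` is a change point with `l < vcp < u`
        (∃ j, 1 ≤ j ∧ j ≤ β ∧ vcp = v (i₀ + j)) → l < vcp → vcp < u →
        -- `‖Θ_{l,u}^{vcp}‖ > Θ_{l,u} − 2C₁ log^p n`
        (∀ k, l < k → k < u →
          ‖cusum um l u k‖ - 2 * C₁ * Real.log n ^ p < ‖cusum um l u vcp‖) →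
        c₁ * (n : ℝ) ^ (1 - ω) - (n : ℝ) ^ ((5 : ℝ) / 8 + ω) * Real.log n ≤
          min ((vcp : ℝ) - (l : ℝ)) ((u : ℝ) - (vcp : ℝ)) := by
  obtain ⟨N, hN⟩ := eventually_atTop.1
    (eventually_cusum_bounds (p := p) hΔ hB hc₁ hω hC₁)
  refine ⟨N, fun n hn m i₀ β l u vcp v μs um ξ _ _ hum hjump hbd hgap hm hl₁ hl₂ hu₁ hu₂ hun
    hM hξ _ ⟨r, hr₁, hrβ, hrl, hru⟩ hs₃ ⟨j, hj₁, hjβ, hj⟩ hlv hvu hmax => ?_⟩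
  obtain ⟨hn₀, h4, ha, hbound⟩ := hN n hn
  set δ := c₁ * (n : ℝ) ^ (1 - ω)
  set a := (n : ℝ) ^ ((5 : ℝ) / 8 + ω) * Real.log n
  have hδ : 0 < δ := by linarith
  have hmono : ∀ {i k : ℕ}, i < k → k ≤ m + 1 → (v i : ℝ) + δ ≤ v k :=
    fun hik hk => add_le_of_forall_succ_sub_ge hδ hgap hik hk
  have hξδ : δ / 2 ≤ ξ * δ := by nlinarith
  have hh₁ : (⌊δ / 2⌋₊ : ℝ) ≤ δ / 2 := Nat.floor_le (by linarith)
  have hh₂ : δ / 4 ≤ ⌊δ / 2⌋₊ := by linarith [Nat.lt_floor_add_one (δ / 2)]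
  generalize ⌊δ / 2⌋₊ = h at hh₁ hh₂
  -- some point near the change point of condition (s₂) has a large statistic
  have hlarge : B * √(2 * a) < ‖cusum um l u vcp‖ := by
    have hlow : (l : ℝ) + h < v (i₀ + r) := by linarith
    have hlow' : l + h < v (i₀ + r) := by exact_mod_cast hlow
    have hup : (v (i₀ + r) : ℝ) + h < u := by linarith
    have hup' : v (i₀ + r) + h < u := by exact_mod_cast hup
    have hprev : v (i₀ + r - 1) + h ≤ v (i₀ + r) := by
      have : (v (i₀ + r - 1) : ℝ) + h ≤ v (i₀ + r) := by
        linarith [@hmono (i₀ + r - 1) (i₀ + r) (by lia) (by lia)]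
      exact_mod_cast this
    have hnext : v (i₀ + r) + h ≤ v (i₀ + r + 1) := by
      have : (v (i₀ + r) : ℝ) + h ≤ v (i₀ + r + 1) := by
        linarith [@hmono (i₀ + r) (i₀ + r + 1) (by lia) (by lia)]
      exact_mod_cast this
    obtain ⟨k, hk₁, hk₂, hk⟩ := exists_le_norm_psum_sub (x := um) (a := μs (i₀ + r))
      (b := μs (i₀ + r + 1)) (v := v (i₀ + r)) (h := h) l (by lia)
      (fun i h₁ h₂ => by
        have hpred : i₀ + r - 1 + 1 = i₀ + r := by lia
        have := hum (i₀ + r - 1) (by lia) i (by lia) (by rwa [hpred])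
        rwa [hpred] at this)
      (fun i h₁ h₂ => hum (i₀ + r) (by lia) i h₁ (by lia))
    have hkl : l < k := by lia
    have hku : k < u := by lia
    have h₁ := norm_psum_sub_div_sqrt_le_norm_cusum hM hkl hku hun
    have h₂ : δ / 4 * Δ / 4 / √n ≤ ‖psum um k - psum um l‖ / √n := by
      refine div_le_div_of_nonneg_right (le_trans ?_ hk) (Real.sqrt_nonneg _)
      have := hjump (i₀ + r) (by lia) (by lia)
      gcongr
    linarith [hmax k hkl hku]
  have hsmall : ∀ d : ℝ, 0 < d → d ≤ a → d ≤ (vcp : ℝ) - l → d ≤ (u : ℝ) - vcp →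
      ¬ ‖psum um vcp - psum um l‖ ≤ d * B := by
    intro d hd hda hdl hdu hle
    have h₁ := norm_cusum_le_mul_sqrt hM hd hdl hdu hle
    have h₂ : B * √(2 * d) ≤ B * √(2 * a) := by gcongr
    linarith
  have hvl : (l : ℝ) < vcp := by exact_mod_cast hlv
  have hvu' : (vcp : ℝ) < u := by exact_mod_cast hvu
  have hl₁' : (v i₀ : ℝ) ≤ l := by exact_mod_cast hl₁
  have hl₂' : (l : ℝ) < v (i₀ + 1) := by exact_mod_cast hl₂
  have hu₁' : (v (i₀ + β) : ℝ) < u := by exact_mod_cast hu₁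
  have hu₂' : (u : ℝ) ≤ v (i₀ + β + 1) := by exact_mod_cast hu₂
  obtain ⟨hs₃l, hs₃u⟩ := max_le_iff.1 hs₃
  rw [Nat.cast_min, Nat.cast_sub hl₂.le, Nat.cast_sub hl₁] at hs₃l
  rw [Nat.cast_min, Nat.cast_sub hu₁.le, Nat.cast_sub hu₂] at hs₃u
  have hweak : ∀ {i k : ℕ}, i ≤ k → k ≤ m + 1 → (v i : ℝ) ≤ v k := by
    intro i k hik hk
    rcases hik.eq_or_lt with rfl | hlt
    · rfl
    · linarith [hmono hlt hk]
  refine le_min ?_ ?_ <;> by_contra! hlt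
  · have hj1 : j = 1 := by
      by_contra hne
      have := @hmono (i₀ + 1) (i₀ + j) (by lia) (by lia)
      rw [hj] at hlt
      have : 0 ≤ a := le_trans (by positivity) hs₃
      linarith
    subst hj1
    have hgap₀ := hgap i₀ (by lia)
    rw [← hj] at hs₃l hgap₀
    have hd : (vcp : ℝ) - l ≤ a := (min_le_iff.1 hs₃l).resolve_right (by intro; linarith)
    have hr := @hweak (i₀ + 1) (i₀ + r) (by lia) (by lia)
    rw [← hj] at hr
    refine hsmall _ (by linarith) hd le_rfl (by linarith) ?_
    rw [psum_sub_psum_of_eq_const hlv.le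
      fun i h₁ h₂ => hum i₀ (by lia) i (by lia) (by rwa [← hj]), norm_smul,
      Real.norm_of_nonneg (by linarith)]
    exact mul_le_mul_of_nonneg_left (hbd _ (by lia) (by lia)) (by linarith)
  · have hj1 : j = β := by
      by_contra hne
      have := @hmono (i₀ + j) (i₀ + β) (by lia) (by lia)
      rw [hj] at hlt
      have : 0 ≤ a := le_trans (by positivity) hs₃
      linarith
    subst hj1
    have hgap₀ := hgap (i₀ + j) (by lia)
    rw [← hj] at hs₃u hgap₀
    have hd : (u : ℝ) - vcp ≤ a := (min_le_iff.1 hs₃u).resolve_right (by intro; linarith)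
    have hr := @hweak (i₀ + r) (i₀ + j) (by lia) (by lia)
    rw [← hj] at hr
    refine hsmall _ (by linarith) hd (by linarith) le_rfl ?_
    rw [← hM, norm_sub_rev, psum_sub_psum_of_eq_const hvu.le
      fun i h₁ h₂ => hum (i₀ + j) (by lia) i (by rwa [← hj]) (by lia), norm_smul,
      Real.norm_of_nonneg (by linarith)]
    exact mul_le_mul_of_nonneg_left (hbd _ (by lia) (by lia)) (by linarith)
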